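/- arXiv:2508.19712 — 2 statements merged into one kernel-verified Lean document; each statement's English description precedes it below -/
import Mathlib

section
/- Let f : ℝ^d → ℝ be convex, twice continuously differentiable with positive definite Hessian ∇²f(x) for every x, and semi-strongly self-concordant with constant L_semi > 0. Let x ∈ ℝ^d and let B_x be an (α̲, ᾱ)-relative inexact Hessian of f at x. Then for every y ∈ ℝ^d: f(y) − Q̄_f(y;x) ≤ (ᾱ/2)‖y − x‖_{B_x}² + ((1 + ᾱ)^{3/2} L_semi / 6)‖y − x‖_{B_x}³. -/
open scoped RealInnerProductSpace

/-- The action of a `d × d` matrix on a vector of `EuclideanSpace ℝ (Fin d)`. -/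
noncomputable def mulV {d : ℕ} (B : Matrix (Fin d) (Fin d) ℝ)
    (v : EuclideanSpace ℝ (Fin d)) : EuclideanSpace ℝ (Fin d) :=
  (EuclideanSpace.equiv (Fin d) ℝ).symm (B.mulVec ((EuclideanSpace.equiv (Fin d) ℝ) v))

/-- The `B`-norm `‖h‖_B = ⟨h, B h⟩^{1/2}`. -/
noncomputable def normB {d : ℕ} (B : Matrix (Fin d) (Fin d) ℝ)
    (h : EuclideanSpace ℝ (Fin d)) : ℝ :=
  Real.sqrt ⟪h, mulV B h⟫

/-- The dual norm `‖g‖_B^* = ⟨g, B⁻¹ g⟩^{1/2}`. -/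
noncomputable def dualNormB {d : ℕ} (B : Matrix (Fin d) (Fin d) ℝ)
    (g : EuclideanSpace ℝ (Fin d)) : ℝ :=
  Real.sqrt ⟪g, mulV B⁻¹ g⟫

/-- The Hessian of `f` at `x`, as a `d × d` matrix (matrix of the Fréchet derivative
of the gradient). -/
noncomputable def hessM {d : ℕ} (f : EuclideanSpace ℝ (Fin d) → ℝ)
    (x : EuclideanSpace ℝ (Fin d)) : Matrix (Fin d) (Fin d) ℝ :=
  fun i j => (fderiv ℝ (gradient f) x (EuclideanSpace.single j (1 : ℝ))) i

/-- `f` is semi-strongly self-concordant with constant `Ls`: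
`‖(∇²f(y) − ∇²f(x)) h‖_{∇²f(x)}^* ≤ Ls ‖y − x‖_{∇²f(x)} ‖h‖_{∇²f(x)}` for all `x y h`. -/
def SemiStrongSelfConcordant {d : ℕ} (f : EuclideanSpace ℝ (Fin d) → ℝ) (Ls : ℝ) : Prop :=
  ∀ x y h : EuclideanSpace ℝ (Fin d),
    dualNormB (hessM f x) (mulV (hessM f y - hessM f x) h) ≤
      Ls * normB (hessM f x) (y - x) * normB (hessM f x) h

/-- `Bx` is an `(al, au)`-relative inexact Hessian of `f` at `x`:
`Bx` is symmetric positive definite, `0 ≤ al ≤ 1`, `0 ≤ au`, and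
`(1 − al) Bx ⪯ ∇²f(x) ⪯ (1 + au) Bx` in the Loewner order. -/
def RelInexactHessian {d : ℕ} (f : EuclideanSpace ℝ (Fin d) → ℝ)
    (x : EuclideanSpace ℝ (Fin d)) (al au : ℝ) (Bx : Matrix (Fin d) (Fin d) ℝ) : Prop :=
  0 ≤ al ∧ al ≤ 1 ∧ 0 ≤ au ∧ Bx.PosDef ∧
    (hessM f x - (1 - al) • Bx).PosSemidef ∧ ((1 + au) • Bx - hessM f x).PosSemidef

/-- The inexact second-order model
`Q̄_f(y;x) = f(x) + ⟨∇f(x), y − x⟩ + ½⟨B_x(y − x), y − x⟩`. -/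
noncomputable def Qbar {d : ℕ} (f : EuclideanSpace ℝ (Fin d) → ℝ)
    (Bx : Matrix (Fin d) (Fin d) ℝ) (x y : EuclideanSpace ℝ (Fin d)) : ℝ :=
  f x + ⟪gradient f x, y - x⟫ + (1 / 2) * ⟪mulV Bx (y - x), y - x⟫

lemma mulV_apply' {d : ℕ} (B : Matrix (Fin d) (Fin d) ℝ) (v : EuclideanSpace ℝ (Fin d)) (i) :
    mulV B v i = ∑ j, B i j * v j := rfl

lemma mulV_add' {d : ℕ} (B : Matrix (Fin d) (Fin d) ℝ) (v w : EuclideanSpace ℝ (Fin d)) :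
    mulV B (v + w) = mulV B v + mulV B w := by
  ext i; simp [mulV_apply', mul_add, Finset.sum_add_distrib]

lemma mulV_smul' {d : ℕ} (B : Matrix (Fin d) (Fin d) ℝ) (t : ℝ) (v : EuclideanSpace ℝ (Fin d)) :
    mulV B (t • v) = t • mulV B v := by
  ext i; simp [mulV_apply', Finset.mul_sum]; congr 1; ext; ring

lemma sub_mulV' {d : ℕ} (A B : Matrix (Fin d) (Fin d) ℝ) (v : EuclideanSpace ℝ (Fin d)) :
    mulV (A - B) v = mulV A v - mulV B v := by
  ext i; simp [mulV_apply', sub_mul]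

lemma smul_mulV' {d : ℕ} (t : ℝ) (B : Matrix (Fin d) (Fin d) ℝ) (v : EuclideanSpace ℝ (Fin d)) :
    mulV (t • B) v = t • mulV B v := by
  ext i; simp [mulV_apply', Finset.mul_sum, mul_assoc]

lemma psd_inner' {d : ℕ} {B : Matrix (Fin d) (Fin d) ℝ} (h : B.PosSemidef)
    (v : EuclideanSpace ℝ (Fin d)) : 0 ≤ ⟪v, mulV B v⟫ := by
  have := h.dotProduct_mulVec_nonneg (EuclideanSpace.equiv (Fin d) ℝ v)
  have e : ⟪v, mulV B v⟫ = star (EuclideanSpace.equiv (Fin d) ℝ v) ⬝ᵥ B.mulVec (EuclideanSpace.equiv (Fin d) ℝ v) := by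
    simp [PiLp.inner_apply, dotProduct, mulV_apply', Matrix.mulVec, mul_comm]
  rw [e]; exact this

lemma mulV_symm' {d : ℕ} {B : Matrix (Fin d) (Fin d) ℝ} (h : B.PosSemidef)
    (v w : EuclideanSpace ℝ (Fin d)) : ⟪w, mulV B v⟫ = ⟪v, mulV B w⟫ := by
  simp only [PiLp.inner_apply, mulV_apply', RCLike.inner_apply, Finset.sum_mul, conj_trivial]
  rw [Finset.sum_comm]
  refine Finset.sum_congr rfl fun i _ => Finset.sum_congr rfl fun j _ => ?_
  have := h.1.apply i j
  simp at this
  rw [this]; ring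

lemma cs' {d : ℕ} {B : Matrix (Fin d) (Fin d) ℝ} (h : B.PosDef)
    (g v : EuclideanSpace ℝ (Fin d)) : ⟪g, v⟫ ≤ dualNormB B g * normB B v := by
  have hs := h.posSemidef
  set w := mulV B⁻¹ g with hw
  have hg : mulV B w = g := by
    have hu : IsUnit B.det := by exact isUnit_iff_ne_zero.2 h.det_pos.ne'
    rw [hw]; unfold mulV
    rw [ContinuousLinearEquiv.apply_symm_apply, Matrix.mulVec_mulVec, Matrix.mul_nonsing_inv _ hu,
      Matrix.one_mulVec, ContinuousLinearEquiv.symm_apply_apply]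
  have key : ∀ t : ℝ, 0 ≤ ⟪v, mulV B v⟫ * (t * t) + (2 * ⟪g, v⟫) * t + ⟪g, w⟫ := by
    intro t
    have := psd_inner' hs (w + t • v)
    rw [mulV_add', mulV_smul', hg] at this
    simp only [inner_add_left, inner_add_right, inner_smul_left, inner_smul_right, conj_trivial] at this
    have e1 : ⟪w, mulV B v⟫ = ⟪g, v⟫ := by rw [mulV_symm' hs, hg, real_inner_comm]
    rw [e1, real_inner_comm g w, real_inner_comm g v] at this
    linarith
  have hd := discrim_le_zero key
  unfold discrim at hd
  have : ⟪g, v⟫ ^ 2 ≤ ⟪g, w⟫ * ⟪v, mulV B v⟫ := by linarith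
  unfold dualNormB normB
  rw [← hw]
  have h0 : 0 ≤ ⟪g, w⟫ := by simpa using key 0
  rw [← Real.sqrt_mul h0]
  exact Real.le_sqrt_of_sq_le this

lemma hess_mulV' {d : ℕ} (f : EuclideanSpace ℝ (Fin d) → ℝ) (x v : EuclideanSpace ℝ (Fin d)) :
    mulV (hessM f x) v = fderiv ℝ (gradient f) x v := by
  have hv : v = ∑ j, v j • EuclideanSpace.single j (1 : ℝ) := by
    ext i; simp [Finset.sum_apply, Pi.single_apply]
  conv_rhs => rw [hv]
  ext i
  simp [mulV_apply', hessM, mul_comm]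

lemma normB_sq' {d : ℕ} {B : Matrix (Fin d) (Fin d) ℝ} (h : B.PosSemidef)
    (v : EuclideanSpace ℝ (Fin d)) : normB B v ^ 2 = ⟪v, mulV B v⟫ :=
  Real.sq_sqrt (psd_inner' h v)

lemma anti' (g g' : ℝ → ℝ) (hg : ∀ t, HasDerivAt g (g' t) t) (h0 : g 0 = 0)
    (hn : ∀ t, 0 ≤ t → g' t ≤ 0) : ∀ t, 0 ≤ t → g t ≤ 0 := by
  intro t ht
  have : AntitoneOn g (Set.Ici 0) := by
    apply antitoneOn_of_deriv_nonpos (convex_Ici 0)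
    · exact fun s _ => (hg s).continuousAt.continuousWithinAt
    · exact fun s _ => (hg s).differentiableAt.differentiableWithinAt
    · intro s hs
      rw [(hg s).deriv]; apply hn; rw [interior_Ici] at hs; exact hs.le
  have := this (Set.mem_Ici.2 le_rfl) (Set.mem_Ici.2 ht) ht
  linarith

/-- upper bound on `f(y) − Q̄_f(y;x)` under semi-strong self-concordance and
relative Hessian inexactness. -/
theorem stmt1 {d : ℕ} (f : EuclideanSpace ℝ (Fin d) → ℝ)
    (hconv : ConvexOn ℝ Set.univ f) (hC2 : ContDiff ℝ 2 f)
    (hpd : ∀ x, (hessM f x).PosDef)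
    (Ls : ℝ) (hLs : 0 < Ls) (hssc : SemiStrongSelfConcordant f Ls)
    (x : EuclideanSpace ℝ (Fin d)) (al au : ℝ) (Bx : Matrix (Fin d) (Fin d) ℝ)
    (hrel : RelInexactHessian f x al au Bx) :
    ∀ y : EuclideanSpace ℝ (Fin d),
      f y - Qbar f Bx x y ≤
        au / 2 * (normB Bx (y - x)) ^ 2 +
          (1 + au) ^ ((3 : ℝ) / 2) * Ls / 6 * (normB Bx (y - x)) ^ 3 := by
  intro y
  obtain ⟨-, -, hau, hB, -, hup⟩ := hrel
  set v := y - x with hv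
  set r := normB (hessM f x) v with hr
  set b := normB Bx v with hb
  have hr0 : 0 ≤ r := Real.sqrt_nonneg _
  have hb0 : 0 ≤ b := Real.sqrt_nonneg _
  have hr2 : r ^ 2 = ⟪v, mulV (hessM f x) v⟫ := normB_sq' (hpd x).posSemidef v
  have hb2 : b ^ 2 = ⟪v, mulV Bx v⟫ := normB_sq' hB.posSemidef v
  have hrb : r ^ 2 ≤ (1 + au) * b ^ 2 := by
    have := psd_inner' hup v
    rw [sub_mulV', smul_mulV', inner_sub_right, inner_smul_right] at this
    rw [hr2, hb2]; linarith
  have hfd : Differentiable ℝ f := hC2.differentiable (by norm_num)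
  have hgd : Differentiable ℝ (gradient f) := by
    have h1 : ContDiff ℝ 1 (fderiv ℝ f) := hC2.fderiv_right (by norm_num)
    have h2 : Differentiable ℝ (fderiv ℝ f) := h1.differentiable (by norm_num)
    exact (InnerProductSpace.toDual ℝ (EuclideanSpace ℝ (Fin d))).symm.differentiable.comp h2
  have hline : ∀ t : ℝ, HasDerivAt (fun t : ℝ => x + t • v) v t := by
    intro t
    simpa using ((hasDerivAt_id t).smul_const v).const_add x
  have hφ : ∀ t : ℝ, HasDerivAt (fun t : ℝ => f (x + t • v)) ⟪gradient f (x + t • v), v⟫ t := by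
    intro t
    have h1 := (hfd (x + t • v)).hasGradientAt.hasFDerivAt
    exact h1.comp_hasDerivAt t (hline t)
  have hφ' : ∀ t : ℝ, HasDerivAt (fun t : ℝ => ⟪gradient f (x + t • v), v⟫)
      ⟪mulV (hessM f (x + t • v)) v, v⟫ t := by
    intro t
    have h1 := (hgd (x + t • v)).hasFDerivAt.comp_hasDerivAt t (hline t)
    rw [hess_mulV']
    have := h1.inner ℝ (hasDerivAt_const t v)
    simpa using this
  have hbound : ∀ t : ℝ, 0 ≤ t → ⟪mulV (hessM f (x + t • v)) v, v⟫ ≤ r ^ 2 + Ls * t * r ^ 3 := by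
    intro t ht
    have h1 := cs' (hpd x) (mulV (hessM f (x + t • v) - hessM f x) v) v
    have h2 := hssc x (x + t • v) v
    have h3 : normB (hessM f x) (x + t • v - x) = t * r := by
      rw [add_sub_cancel_left, hr]; unfold normB
      rw [mulV_smul', inner_smul_left, inner_smul_right, conj_trivial, ← mul_assoc,
        Real.sqrt_mul (by positivity), Real.sqrt_mul_self ht]
    rw [h3, ← hr] at h2
    rw [← hr] at h1
    have h4 := h1.trans (mul_le_mul_of_nonneg_right h2 hr0)
    rw [sub_mulV', inner_sub_left, real_inner_comm v (mulV (hessM f x) v), ← hr2] at h4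
    linarith [h4]
  have hψ' := anti' (fun t => ⟪gradient f (x + t • v), v⟫ - ⟪gradient f x, v⟫ - t * r ^ 2
      - Ls * r ^ 3 / 2 * t ^ 2)
    (fun t => ⟪mulV (hessM f (x + t • v)) v, v⟫ - r ^ 2 - Ls * r ^ 3 * t)
    (by
      intro t
      have := (((hφ' t).sub_const ⟪gradient f x, v⟫).sub ((hasDerivAt_id t).mul_const (r ^ 2))).sub
        (((hasDerivAt_id t).pow 2).const_mul (Ls * r ^ 3 / 2))
      refine this.congr_deriv ?_
      simp; ring)
    (by simp)
    (by intro t ht; have := hbound t ht; linarith)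
  have hψ := anti' (fun t => f (x + t • v) - f x - t * ⟪gradient f x, v⟫ - r ^ 2 / 2 * t ^ 2
      - Ls * r ^ 3 / 6 * t ^ 3)
    (fun t => ⟪gradient f (x + t • v), v⟫ - ⟪gradient f x, v⟫ - t * r ^ 2
      - Ls * r ^ 3 / 2 * t ^ 2)
    (by
      intro t
      have := ((((hφ t).sub_const (f x)).sub ((hasDerivAt_id t).mul_const ⟪gradient f x, v⟫)).sub
        (((hasDerivAt_id t).pow 2).const_mul (r ^ 2 / 2))).sub
        (((hasDerivAt_id t).pow 3).const_mul (Ls * r ^ 3 / 6))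
      refine this.congr_deriv ?_
      simp; ring)
    (by simp) hψ' 1 zero_le_one
  have hy : x + (1 : ℝ) • v = y := by simp [hv]
  simp only [hy] at hψ
  have hr3 : r ^ 3 ≤ (1 + au) ^ ((3 : ℝ) / 2) * b ^ 3 := by
    have h1 : 0 ≤ 1 + au := by linarith
    have hs : (1 + au) ^ ((3 : ℝ) / 2) = Real.sqrt (1 + au) ^ 3 := by
      rw [Real.sqrt_eq_rpow, ← Real.rpow_natCast, ← Real.rpow_mul h1]; norm_num
    rw [hs, ← mul_pow]
    refine pow_le_pow_left₀ hr0 ?_ 3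
    refine (sq_le_sq₀ hr0 (by positivity)).1 ?_
    rw [mul_pow, Real.sq_sqrt h1]; exact hrb
  unfold Qbar
  rw [← hv, real_inner_comm v (mulV Bx v), ← hb2]
  have := mul_le_mul_of_nonneg_left hr3 hLs.le
  linarith
end

section
/- Let f : ℝ^d → ℝ be convex, twice continuously differentiable with positive definite Hessian everywhere, and semi-strongly self-concordant with constant L_semi > 0. Let x_k ∈ ℝ^d, let B_k be an (α̲, ᾱ)-relative inexact Hessian of f at x_k with α_max := max(α̲, ᾱ), let θ ≥ 1 + α_max and L ≥ (1 + ᾱ)^{3/2} L_semi, let η > 0 be the unique positive solution of (2L/3) η² ‖∇f(x_k)‖_{B_k}^* + θ η = 1, and set x_{k+1} := x_k − η B_k⁻¹ ∇f(x_k), so that the step h := x_{k+1} − x_k satisfies the first-order condition ∇f(x_k) + θ B_k h + (2L/3)‖h‖_{B_k} B_k h = 0. Then f(x_{k+1}) ≤ f(x_k) − (1/2) η (‖∇f(x_k)‖_{B_k}^*)² − (L/6) η³ (‖∇f(x_k)‖_{B_k}^*)³. -/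
open scoped RealInnerProductSpace

theorem mulV_toLp {d : ℕ} (B : Matrix (Fin d) (Fin d) ℝ) (v : EuclideanSpace ℝ (Fin d)) :
    mulV B v = WithLp.toLp 2 (B.mulVec v.ofLp) := rfl

theorem mulV_eq {d : ℕ} (B : Matrix (Fin d) (Fin d) ℝ) (v : EuclideanSpace ℝ (Fin d)) :
    mulV B v = Matrix.toEuclideanLin B v := by
  ext i; simp [mulV_toLp, Matrix.toLpLin_apply]

theorem mulV_inv {d : ℕ} {B : Matrix (Fin d) (Fin d) ℝ} (hB : B.PosDef)
    (v : EuclideanSpace ℝ (Fin d)) : mulV B (mulV B⁻¹ v) = v := by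
  have hu : IsUnit B.det := hB.det_pos.ne'.isUnit
  ext i
  simp [mulV_toLp, Matrix.mulVec_mulVec, Matrix.mul_nonsing_inv _ hu]

theorem inner_mulV {d : ℕ} (B : Matrix (Fin d) (Fin d) ℝ) (u v : EuclideanSpace ℝ (Fin d)) :
    ⟪u, mulV B v⟫ = u.ofLp ⬝ᵥ (B.mulVec v.ofLp) := by
  simp [mulV_toLp, PiLp.inner_apply, dotProduct, mul_comm]

theorem inner_nonneg_psd {d : ℕ} {B : Matrix (Fin d) (Fin d) ℝ} (hB : B.PosSemidef)
    (u : EuclideanSpace ℝ (Fin d)) : 0 ≤ ⟪u, mulV B u⟫ := by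
  rw [inner_mulV]
  simpa using hB.dotProduct_mulVec_nonneg u.ofLp

theorem inner_symm_psd {d : ℕ} {B : Matrix (Fin d) (Fin d) ℝ} (hB : B.IsHermitian)
    (u v : EuclideanSpace ℝ (Fin d)) : ⟪u, mulV B v⟫ = ⟪v, mulV B u⟫ := by
  have hT : B.transpose = B := by simpa using hB.eq
  rw [inner_mulV, inner_mulV, Matrix.dotProduct_mulVec, dotProduct_comm,
    ← Matrix.mulVec_transpose, hT]

theorem cs_B {d : ℕ} {B : Matrix (Fin d) (Fin d) ℝ} (hB : B.PosDef)
    (g h : EuclideanSpace ℝ (Fin d)) : ⟪g, h⟫ ≤ dualNormB B g * normB B h := by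
  unfold dualNormB normB
  have hg : 0 ≤ ⟪g, mulV B⁻¹ g⟫ := inner_nonneg_psd hB.inv.posSemidef g
  have key : ∀ t : ℝ, 0 ≤ ⟪g, mulV B⁻¹ g⟫ * (t * t) + (2 * ⟪g, h⟫) * t + ⟪h, mulV B h⟫ := by
    intro t
    have h0 := inner_nonneg_psd hB.posSemidef (h + t • mulV B⁻¹ g)
    have e1 : mulV B (h + t • mulV B⁻¹ g) = mulV B h + t • g := by
      conv_rhs => rw [← mulV_inv hB g]
      simp only [mulV_eq, map_add, map_smul]
    have e2 : ⟪mulV B⁻¹ g, mulV B h⟫ = ⟪g, h⟫ := by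
      rw [inner_symm_psd hB.isHermitian, mulV_inv hB, real_inner_comm]
    rw [e1] at h0
    simp only [inner_add_left, inner_add_right, inner_smul_left, inner_smul_right, e2] at h0
    rw [real_inner_comm g h, real_inner_comm g (mulV B⁻¹ g)] at h0
    simp only [conj_trivial] at h0
    linarith
  have hd := discrim_le_zero key
  unfold discrim at hd
  rw [← Real.sqrt_mul hg]
  apply Real.le_sqrt_of_sq_le
  linarith

theorem hess_apply {d : ℕ} (f : EuclideanSpace ℝ (Fin d) → ℝ)
    (x h : EuclideanSpace ℝ (Fin d)) : mulV (hessM f x) h = fderiv ℝ (gradient f) x h := by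
  have hh : h = ∑ j, h j • EuclideanSpace.single j (1 : ℝ) := by
    ext i; simp [Pi.single_apply]
  conv_rhs => rw [hh]
  rw [map_sum]
  ext i
  simp [mulV, hessM, Matrix.mulVec, dotProduct, mul_comm]

theorem grad_diff {d : ℕ} {f : EuclideanSpace ℝ (Fin d) → ℝ} (hC2 : ContDiff ℝ 2 f) :
    Differentiable ℝ (gradient f) := by
  have h1 : Differentiable ℝ (fderiv ℝ f) :=
    (hC2.fderiv_right (m := 1) (by norm_num)).differentiable (by norm_num)
  exact (InnerProductSpace.toDual ℝ
    (EuclideanSpace ℝ (Fin d))).symm.toContinuousLinearEquiv.differentiable.comp h1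

theorem mono_aux (G G' : ℝ → ℝ) (hG : ∀ t, HasDerivAt G (G' t) t)
    (hn : ∀ t, 0 ≤ t → 0 ≤ G' t) (t : ℝ) (ht : 0 ≤ t) : G 0 ≤ G t := by
  have hm : MonotoneOn G (Set.Ici 0) := by
    apply monotoneOn_of_deriv_nonneg (convex_Ici 0)
    · exact fun s _ => (hG s).continuousAt.continuousWithinAt
    · exact fun s _ => (hG s).differentiableAt.differentiableWithinAt
    · intro s hs
      rw [(hG s).deriv]
      exact hn s (by simpa using (interior_subset hs))
  exact hm (by simp) (by simpa using ht) ht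

theorem taylor_aux (p p1 p2 : ℝ → ℝ) (h1 : ∀ t, HasDerivAt p (p1 t) t)
    (h2 : ∀ t, HasDerivAt p1 (p2 t) t) (a b : ℝ) (hb : ∀ t, 0 ≤ t → p2 t ≤ a + b * t) :
    p 1 ≤ p 0 + p1 0 + a / 2 + b / 6 := by
  have A : ∀ t, 0 ≤ t → p1 t ≤ p1 0 + a * t + b / 2 * t ^ 2 := by
    intro t ht
    have := mono_aux (fun t => a * t + b / 2 * t ^ 2 - p1 t)
      (fun t => a * 1 + b / 2 * (2 * t) - p2 t)
      (fun t => (((hasDerivAt_id t).const_mul a).add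
        (((hasDerivAt_pow 2 t).const_mul (b / 2)).congr_deriv (by simp))).sub (h2 t))
      (fun t ht => by have := hb t ht; nlinarith) t ht
    simp at this; linarith
  have := mono_aux (fun t => p1 0 * t + a / 2 * t ^ 2 + b / 6 * t ^ 3 - p t)
      (fun t => p1 0 * 1 + a / 2 * (2 * t) + b / 6 * (3 * t ^ 2) - p1 t)
      (fun t => ((((hasDerivAt_id t).const_mul (p1 0)).add
        (((hasDerivAt_pow 2 t).const_mul (a / 2)).congr_deriv (by simp))).add
        (((hasDerivAt_pow 3 t).const_mul (b / 6)).congr_deriv (by simp))).sub (h1 t))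
      (fun t ht => by have := A t ht; nlinarith) 1 zero_le_one
  simp at this; linarith

theorem cubic_bound {d : ℕ} (f : EuclideanSpace ℝ (Fin d) → ℝ) (hC2 : ContDiff ℝ 2 f)
    (hpd : ∀ x, (hessM f x).PosDef) (Ls : ℝ) (hssc : SemiStrongSelfConcordant f Ls)
    (x h : EuclideanSpace ℝ (Fin d)) :
    f (x + h) ≤ f x + ⟪gradient f x, h⟫ + ⟪h, mulV (hessM f x) h⟫ / 2
      + Ls * normB (hessM f x) h ^ 3 / 6 := by
  have hl : ∀ t : ℝ, HasDerivAt (fun t : ℝ => x + t • h) h t := fun t => by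
    simpa using ((hasDerivAt_id t).smul_const h).const_add x
  have hf : Differentiable ℝ f := hC2.differentiable (by norm_num)
  have := taylor_aux (fun t => f (x + t • h)) (fun t => ⟪gradient f (x + t • h), h⟫)
    (fun t => ⟪mulV (hessM f (x + t • h)) h, h⟫)
    (fun t => by
      have := (hf (x + t • h)).hasGradientAt.hasFDerivAt.comp_hasDerivAt t (hl t)
      exact this.congr_deriv (by simp))
    (fun t => by
      have := ((grad_diff hC2) (x + t • h)).hasFDerivAt.comp_hasDerivAt t (hl t)
      have := this.inner ℝ (hasDerivAt_const t h)
      simpa [hess_apply] using this)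
    ⟪h, mulV (hessM f x) h⟫ (Ls * normB (hessM f x) h ^ 3)
    (fun t ht => by
      have c := cs_B (hpd x) (mulV (hessM f (x + t • h) - hessM f x) h) h
      have s := hssc x (x + t • h) h
      have hn : 0 ≤ normB (hessM f x) h := Real.sqrt_nonneg _
      have e : normB (hessM f x) (x + t • h - x) = t * normB (hessM f x) h := by
        rw [add_sub_cancel_left]
        simp only [normB, mulV_eq, map_smul, inner_smul_left, inner_smul_right, conj_trivial]
        rw [← mul_assoc, Real.sqrt_mul (by positivity), Real.sqrt_mul_self ht]
      rw [e] at s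
      have e2 : mulV (hessM f (x + t • h) - hessM f x) h
          = mulV (hessM f (x + t • h)) h - mulV (hessM f x) h := by
        simp [mulV_eq]
      have c2 := mul_le_mul_of_nonneg_right s hn
      have c3 : ⟪mulV (hessM f (x + t • h)) h - mulV (hessM f x) h, h⟫ ≤ _ := e2 ▸ c.trans c2
      rw [inner_sub_left, real_inner_comm h (mulV (hessM f x) h)] at c3
      linarith)
  simpa using this

/-- one-step decrease of the CEQN step with cubic coefficient `2L/3`,
including the first-order condition satisfied by the step. -/
theorem stmt10 {d : ℕ} (f : EuclideanSpace ℝ (Fin d) → ℝ)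
    (hconv : ConvexOn ℝ Set.univ f) (hC2 : ContDiff ℝ 2 f)
    (hpd : ∀ x, (hessM f x).PosDef)
    (Ls : ℝ) (hLs : 0 < Ls) (hssc : SemiStrongSelfConcordant f Ls)
    (xk : EuclideanSpace ℝ (Fin d)) (al au : ℝ) (Bk : Matrix (Fin d) (Fin d) ℝ)
    (hrel : RelInexactHessian f xk al au Bk)
    (θ L : ℝ) (hθ : 1 + max al au ≤ θ) (hL : (1 + au) ^ ((3 : ℝ) / 2) * Ls ≤ L)
    (η : ℝ) (hη : 0 < η)
    (heq : 2 * L / 3 * η ^ 2 * dualNormB Bk (gradient f xk) + θ * η = 1)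
    (xk1 : EuclideanSpace ℝ (Fin d))
    (hstep : xk1 = xk - η • mulV Bk⁻¹ (gradient f xk)) :
    gradient f xk + θ • mulV Bk (xk1 - xk) +
        (2 * L / 3 * normB Bk (xk1 - xk)) • mulV Bk (xk1 - xk) = 0 ∧
    f xk1 ≤ f xk - 1 / 2 * η * (dualNormB Bk (gradient f xk)) ^ 2 -
        L / 6 * η ^ 3 * (dualNormB Bk (gradient f xk)) ^ 3 := by
  obtain ⟨_, _, hau, hB, _, hup⟩ := hrel
  set g := gradient f xk with hg
  set N := dualNormB Bk g with hN
  have hN0 : 0 ≤ N := Real.sqrt_nonneg _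
  have hNsq : ⟪g, mulV Bk⁻¹ g⟫ = N ^ 2 :=
    (Real.sq_sqrt (inner_nonneg_psd hB.inv.posSemidef g)).symm
  have hh : xk1 - xk = (-η) • mulV Bk⁻¹ g := by rw [hstep]; module
  have hBh : mulV Bk (xk1 - xk) = (-η) • g := by
    rw [hh]
    conv_rhs => rw [← mulV_inv hB g]
    simp only [mulV_eq, map_smul]
  have hq : ⟪xk1 - xk, mulV Bk (xk1 - xk)⟫ = (η * N) ^ 2 := by
    rw [hBh, hh, inner_smul_left, inner_smul_right, real_inner_comm, hNsq]
    simp only [conj_trivial]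
    ring
  have hr : normB Bk (xk1 - xk) = η * N := by
    rw [normB, hq, Real.sqrt_sq (by positivity)]
  refine ⟨?_, ?_⟩
  · rw [hr, hBh, smul_smul, smul_smul]
    have : g + (θ * -η) • g + (2 * L / 3 * (η * N) * -η) • g
        = (1 - (2 * L / 3 * η ^ 2 * N + θ * η)) • g := by module
    rw [this, heq]; simp
  · have hc := cubic_bound f hC2 hpd Ls hssc xk (xk1 - xk)
    rw [add_sub_cancel] at hc
    have hgh : ⟪g, xk1 - xk⟫ = -(η * N ^ 2) := by
      rw [hh, inner_smul_right, hNsq]; ring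
    rw [← hg, hgh] at hc
    have hH : ⟪xk1 - xk, mulV (hessM f xk) (xk1 - xk)⟫ ≤ (1 + au) * (η * N) ^ 2 := by
      have := inner_nonneg_psd hup (xk1 - xk)
      have e : mulV ((1 + au) • Bk - hessM f xk) (xk1 - xk)
          = (1 + au) • mulV Bk (xk1 - xk) - mulV (hessM f xk) (xk1 - xk) := by
        rw [mulV_eq, map_sub Matrix.toEuclideanLin, LinearMap.sub_apply,
          map_smul Matrix.toEuclideanLin, LinearMap.smul_apply, ← mulV_eq, ← mulV_eq]
      rw [e, inner_sub_right, inner_smul_right, hq] at this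
      linarith
    have hcube : Ls * normB (hessM f xk) (xk1 - xk) ^ 3 ≤ L * (η * N) ^ 3 := by
      have h1 : normB (hessM f xk) (xk1 - xk) ≤ Real.sqrt (1 + au) * (η * N) := by
        rw [normB, ← Real.sqrt_sq (show 0 ≤ η * N by positivity), ← Real.sqrt_mul (by positivity)]
        exact Real.sqrt_le_sqrt hH
      have h2 := pow_le_pow_left₀ (Real.sqrt_nonneg _) h1 3
      have h3 : (1 + au) ^ ((3 : ℝ) / 2) = Real.sqrt (1 + au) ^ 3 := by
        rw [Real.sqrt_eq_rpow, ← Real.rpow_natCast, ← Real.rpow_mul (by positivity)]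
        norm_num
      rw [h3] at hL
      calc _ ≤ Ls * (Real.sqrt (1 + au) * (η * N)) ^ 3 := mul_le_mul_of_nonneg_left h2 hLs.le
        _ = (Real.sqrt (1 + au) ^ 3 * Ls) * (η * N) ^ 3 := by ring
        _ ≤ _ := mul_le_mul_of_nonneg_right hL (by positivity)
    have hθ' : 1 + au ≤ θ := le_trans (by linarith [le_max_right al au]) hθ
    have h4 : (1 + au) * (η * N) ^ 2 ≤ θ * (η * N) ^ 2 :=
      mul_le_mul_of_nonneg_right hθ' (by positivity)
    have h5 : θ * (η * N) ^ 2 = η * N ^ 2 - 2 * L / 3 * η ^ 3 * N ^ 3 := by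
      linear_combination η * N ^ 2 * heq
    have h6 : L * (η * N) ^ 3 = L * η ^ 3 * N ^ 3 := by ring
    rw [h6] at hcube
    linarith
end
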